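/- Let 1/4 ≤ α < 5/12. Then there exist ε > 0 and C > 0, depending only on α, such that for all signs σ, σ₂, σ₃, σ₄ ∈ {−1, 1}, all dyadic numbers N₂, N₃, N₄, and every m ∈ ℤ: ∑_{n₂,n₃,n₄ ∈ ℤ²} ⟨n₂+n₃+n₄⟩^{−1} · ⟨n₃+n₄⟩^{−1} · ∏_{j=2}^{4} [ 1_{|n_j| ∼ N_j} · ⟨n_j⟩^{−2+2α} ] · 1_{|ψ(n₂,n₃,n₄) − m| ≤ 1} ≤ C · max(N₂, N₃, N₄)^{−2ε}. -/

import Mathlib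

/-- The Euclidean norm of a lattice point `x ∈ ℤ²`. -/
noncomputable def znorm (x : Fin 2 → ℤ) : ℝ :=
  Real.sqrt ((x 0 : ℝ) ^ 2 + (x 1 : ℝ) ^ 2)

/-- The Japanese bracket `⟨x⟩ = √(1 + |x|²)` for lattice points `x ∈ ℤ²`. -/
noncomputable def jb (x : Fin 2 → ℤ) : ℝ :=
  Real.sqrt (1 + (x 0 : ℝ) ^ 2 + (x 1 : ℝ) ^ 2)

/-- `|x| ∼ N`, i.e. `N/2 ≤ |x| ≤ 2N`. -/
def ann (N : ℝ) (x : Fin 2 → ℤ) : Prop :=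
  N / 2 ≤ znorm x ∧ znorm x ≤ 2 * N

/-- The cubic phase function `φ(n₁,n₂,n₃) = σ⟨n₁+n₂+n₃⟩ + σ₁⟨n₁⟩ + σ₂⟨n₂⟩ + σ₃⟨n₃⟩`. -/
noncomputable def phase (σ σ₁ σ₂ σ₃ : ℝ) (n₁ n₂ n₃ : Fin 2 → ℤ) : ℝ :=
  σ * jb (n₁ + n₂ + n₃) + σ₁ * jb n₁ + σ₂ * jb n₂ + σ₃ * jb n₃

/-- The median (middle value) of three real numbers. -/
noncomputable def med3 (a b c : ℝ) : ℝ :=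
  max (min a b) (min (max a b) c)

theorem card_le_of_sub_le {ι : Type*} (F : Finset ι) (g : ι → ℤ) (D : ℝ) (hD : 0 ≤ D)
    (hg : ∀ x ∈ F, ∀ y ∈ F, g x = g y → x = y)
    (h : ∀ x ∈ F, ∀ y ∈ F, (g x : ℝ) - g y ≤ D) : (F.card : ℝ) ≤ D + 1 := by
  classical
  rcases F.eq_empty_or_nonempty with rfl | hne
  · simp; linarith
  obtain ⟨z, hz, hmin⟩ := F.exists_min_image g hne
  have hcard : F.card ≤ (Finset.Icc (g z) (g z + ⌊D⌋)).card := by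
    refine Finset.card_le_card_of_injOn g ?_ (fun x hx y hy => hg x hx y hy)
    intro x hx
    simp only [Finset.coe_Icc, Set.mem_Icc]
    refine ⟨hmin x hx, ?_⟩
    have : g x - g z ≤ ⌊D⌋ := Int.le_floor.mpr (by push_cast; exact h x hx z hz)
    linarith
  have hfl : (0 : ℤ) ≤ ⌊D⌋ := Int.floor_nonneg.mpr hD
  have h2 : (F.card : ℤ) ≤ ⌊D⌋ + 1 := by
    rw [Int.card_Icc] at hcard
    omega
  have h3 : (F.card : ℝ) ≤ (⌊D⌋ : ℝ) + 1 := by exact_mod_cast h2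
  linarith [Int.floor_le D]

theorem card_sector_le {ι : Type*} (F : Finset ι) (X Y : ι → ℤ) (r D : ℝ) (hr : 1 ≤ r)
    (hD : 0 ≤ D)
    (hinj : ∀ n ∈ F, ∀ n' ∈ F, X n = X n' → Y n = Y n' → n = n')
    (hlow : ∀ n ∈ F, r ^ 2 ≤ 1 + (X n : ℝ) ^ 2 + (Y n : ℝ) ^ 2)
    (hup : ∀ n ∈ F, 1 + (X n : ℝ) ^ 2 + (Y n : ℝ) ^ 2 ≤ (r + 1) ^ 2)
    (hXY : ∀ n ∈ F, |Y n| ≤ X n)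
    (hd : ∀ n ∈ F, ∀ n' ∈ F, (Y n : ℝ) - Y n' ≤ D) : (F.card : ℝ) ≤ 4 * (D + 1) := by
  classical
  have hfib : ∀ b ∈ F.image Y, (F.filter (fun n => Y n = b)).card ≤ 4 := by
    intro b _
    have : ((F.filter (fun n => Y n = b)).card : ℝ) ≤ 3 + 1 := by
      refine card_le_of_sub_le _ X 3 (by norm_num) ?_ ?_
      · intro x hx y hy hxy
        rw [Finset.mem_filter] at hx hy
        exact hinj x hx.1 y hy.1 hxy (hx.2.trans hy.2.symm)
      · intro x hx y hy
        rw [Finset.mem_filter] at hx hy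
        by_contra! hlt
        have h4 : (4 : ℤ) ≤ X x - X y := by
          have : (3 : ℤ) < X x - X y := by exact_mod_cast hlt
          linarith
        have h4' : (4 : ℝ) ≤ (X x : ℝ) - X y := by exact_mod_cast h4
        have hYY : (Y x : ℝ) = Y y := by rw [hx.2, hy.2]
        have h1 := hup x hx.1
        have h2 := hlow y hy.1
        have h3 : |(Y y : ℝ)| ≤ X y := by exact_mod_cast hXY y hy.1
        have h0 : (0 : ℝ) ≤ X y := (abs_nonneg _).trans h3
        have hy2 : (Y y : ℝ) ^ 2 ≤ (X y : ℝ) ^ 2 := sq_le_sq' (by linarith [neg_abs_le (Y y : ℝ)])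
          (by linarith [le_abs_self (Y y : ℝ)])
        rw [hYY] at h1
        have h5 : 8 * (X y : ℝ) + 16 ≤ 2 * r + 1 := by nlinarith
        nlinarith
    have h' : ((F.filter (fun n => Y n = b)).card : ℝ) ≤ ((4 : ℕ) : ℝ) := by
      push_cast; linarith
    exact_mod_cast h'
  have hmul := Finset.card_le_mul_card_image F 4 hfib
  have himg : ((F.image Y).card : ℝ) ≤ D + 1 := by
    refine card_le_of_sub_le _ id D hD (fun x _ y _ h => h) ?_
    intro x hx y hy
    obtain ⟨n, hn, rfl⟩ := Finset.mem_image.mp hx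
    obtain ⟨n', hn', rfl⟩ := Finset.mem_image.mp hy
    exact hd n hn n' hn'
  have : (F.card : ℝ) ≤ 4 * ((F.image Y).card : ℝ) := by exact_mod_cast hmul
  linarith

theorem jb_sq (x : Fin 2 → ℤ) : jb x ^ 2 = 1 + (x 0 : ℝ) ^ 2 + (x 1 : ℝ) ^ 2 :=
  Real.sq_sqrt (by positivity)

theorem one_le_jb (x : Fin 2 → ℤ) : 1 ≤ jb x :=
  Real.one_le_sqrt.mpr (by nlinarith [sq_nonneg (x 0 : ℝ), sq_nonneg (x 1 : ℝ)])

theorem jb_pos (x : Fin 2 → ℤ) : 0 < jb x := one_pos.trans_le (one_le_jb x)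

theorem jb_neg (x : Fin 2 → ℤ) : jb (-x) = jb x := by simp [jb]

theorem jb_le_add (x a : Fin 2 → ℤ) : jb a ≤ jb x + jb (x + a) := by
  have h1 := jb_sq x
  have h2 := jb_sq a
  have h3 := jb_sq (x + a)
  simp only [Pi.add_apply, Int.cast_add] at h3
  have p1 := one_le_jb x
  have p3 := one_le_jb (x + a)
  apply le_of_sq_le_sq _ (by positivity)
  have key : -(jb x * jb (x + a)) ≤ (x 0 : ℝ) * (x 0 + a 0) + x 1 * (x 1 + a 1) := by
    have : |(x 0 : ℝ) * (x 0 + a 0) + x 1 * (x 1 + a 1)| ≤ jb x * jb (x + a) := by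
      apply abs_le_of_sq_le_sq _ (by positivity)
      rw [mul_pow, h1, h3]
      nlinarith [sq_nonneg ((x 0 : ℝ) * (x 1 + a 1) - x 1 * (x 0 + a 0)), sq_nonneg (x 0 : ℝ),
        sq_nonneg (x 1 : ℝ), sq_nonneg (x 0 + a 0 : ℝ), sq_nonneg (x 1 + a 1 : ℝ)]
    linarith [neg_le_of_abs_le this]
  nlinarith

theorem sq_sub_le_abs_sq_sub_sq (q q' : ℝ) (h : 0 ≤ q * q') : (q - q') ^ 2 ≤ |q ^ 2 - q' ^ 2| := by
  have h1 : |q - q'| ≤ |q + q'| := sq_le_sq.mp (by linarith)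
  calc (q - q') ^ 2 = |q - q'| * |q - q'| := by rw [abs_mul_abs_self]; ring
    _ ≤ |q - q'| * |q + q'| := by gcongr
    _ = _ := by rw [← abs_mul]; congr 1; ring

theorem sq_dist_mul_le (x y x' y' a0 a1 A r s : ℝ) (hr : 1 ≤ r) (hrs : r ≤ s) (hA : 1 ≤ A)
    (ea : A ^ 2 = 1 + a0 ^ 2 + a1 ^ 2) (hone : 1 ≤ a0 ^ 2 + a1 ^ 2) (hA4 : A ≤ 4 * s)
    (g1 : r ^ 2 ≤ 1 + x ^ 2 + y ^ 2) (g2 : 1 + x ^ 2 + y ^ 2 ≤ (r + 1) ^ 2)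
    (g1' : r ^ 2 ≤ 1 + x' ^ 2 + y' ^ 2) (g2' : 1 + x' ^ 2 + y' ^ 2 ≤ (r + 1) ^ 2)
    (g3 : s ^ 2 ≤ 1 + (x + a0) ^ 2 + (y + a1) ^ 2)
    (g4 : 1 + (x + a0) ^ 2 + (y + a1) ^ 2 ≤ (s + 1) ^ 2)
    (g3' : s ^ 2 ≤ 1 + (x' + a0) ^ 2 + (y' + a1) ^ 2)
    (g4' : 1 + (x' + a0) ^ 2 + (y' + a1) ^ 2 ≤ (s + 1) ^ 2)
    (hq : 0 ≤ (x * a1 - y * a0) * (x' * a1 - y' * a0)) :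
    ((x - x') ^ 2 + (y - y') ^ 2) * A ≤ 72 * (r * s) := by
  have hA0 : A ^ 2 ≤ 2 * (a0 ^ 2 + a1 ^ 2) := by linarith
  have hpp : |(x * a0 + y * a1) - (x' * a0 + y' * a1)| ≤ 3 * s := by
    rw [abs_le]; constructor <;> linarith
  have hp : ∀ u v : ℝ, 1 + u ^ 2 + v ^ 2 ≤ (r + 1) ^ 2 → |u * a0 + v * a1| ≤ 2 * r * A := by
    intro u v huv
    apply abs_le_of_sq_le_sq _ (by positivity)
    have : (u * a0 + v * a1) ^ 2 ≤ (u ^ 2 + v ^ 2) * (a0 ^ 2 + a1 ^ 2) := by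
      nlinarith [sq_nonneg (u * a1 - v * a0)]
    have h5 : (u ^ 2 + v ^ 2) * (a0 ^ 2 + a1 ^ 2) ≤ (2 * r) ^ 2 * A ^ 2 := by
      have h6 : (r + 1) ^ 2 ≤ (2 * r) ^ 2 := by gcongr; linarith
      apply mul_le_mul (by linarith) (by linarith) (by positivity) (by positivity)
    calc _ ≤ _ := this
      _ ≤ _ := h5
      _ = _ := by ring
  have hp1 := hp x y g2
  have hp1' := hp x' y' g2'
  set p := x * a0 + y * a1 with hpdef
  set p' := x' * a0 + y' * a1 with hpdef'
  set q := x * a1 - y * a0 with hqdef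
  set q' := x' * a1 - y' * a0 with hqdef'
  set B := a0 ^ 2 + a1 ^ 2 with hB
  have hBA : B ≤ A ^ 2 := by linarith
  have ident : ((x - x') ^ 2 + (y - y') ^ 2) * B = (p - p') ^ 2 + (q - q') ^ 2 := by
    rw [hB, hpdef, hpdef', hqdef, hqdef']; ring
  have i1 : p ^ 2 + q ^ 2 = (x ^ 2 + y ^ 2) * B := by rw [hB, hpdef, hqdef]; ring
  have i2 : p' ^ 2 + q' ^ 2 = (x' ^ 2 + y' ^ 2) * B := by rw [hB, hpdef', hqdef']; ring
  have hsum : |p + p'| ≤ 4 * r * A := (abs_add_le _ _).trans (by linarith)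
  have hdiff : |p - p'| ≤ 4 * r * A := (abs_sub _ _).trans (by linarith)
  have hpsq : |p ^ 2 - p' ^ 2| ≤ 12 * (r * s * A) := by
    have : p ^ 2 - p' ^ 2 = (p - p') * (p + p') := by ring
    rw [this, abs_mul]
    calc _ ≤ (3 * s) * (4 * r * A) := mul_le_mul hpp hsum (abs_nonneg _) (by linarith)
      _ = _ := by ring
  have hpd : (p - p') ^ 2 ≤ 12 * (r * s * A) := by
    rw [← sq_abs, sq]
    calc _ ≤ (3 * s) * (4 * r * A) := mul_le_mul hpp hdiff (abs_nonneg _) (by linarith)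
      _ = _ := by ring
  have hn : |(x ^ 2 + y ^ 2) * B - (x' ^ 2 + y' ^ 2) * B| ≤ 12 * (r * s * A) := by
    rw [← sub_mul, abs_mul, abs_of_nonneg (by linarith : 0 ≤ B)]
    have : |x ^ 2 + y ^ 2 - (x' ^ 2 + y' ^ 2)| ≤ 3 * r := by
      rw [abs_le]; constructor <;> linarith
    calc _ ≤ 3 * r * A ^ 2 := mul_le_mul this hBA (by linarith) (by linarith)
      _ = 3 * r * A * A := by ring
      _ ≤ 3 * r * A * (4 * s) := by gcongr
      _ = _ := by ring
  have hqd := sq_sub_le_abs_sq_sub_sq q q' hq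
  have hqs : |q ^ 2 - q' ^ 2| ≤ 24 * (r * s * A) := by
    rw [abs_le] at hn hpsq ⊢
    constructor <;> linarith [hn.1, hn.2, hpsq.1, hpsq.2]
  have hfin : ((x - x') ^ 2 + (y - y') ^ 2) * B ≤ 36 * (r * s * A) := by linarith
  have : ((x - x') ^ 2 + (y - y') ^ 2) * A * A ≤ 72 * (r * s) * A := by
    calc _ = ((x - x') ^ 2 + (y - y') ^ 2) * A ^ 2 := by ring
      _ ≤ ((x - x') ^ 2 + (y - y') ^ 2) * (2 * B) := by gcongr
      _ ≤ _ := by linarith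
  exact le_of_mul_le_mul_right this (by linarith)

/-- Lattice points in the intersection of two unit-thickness annuli, lying on the same side of
the line joining the centres, are close to each other. -/
theorem sq_dist_le_of_shells (n n' a : Fin 2 → ℤ) (r s : ℝ) (hr : 1 ≤ r) (hrs : r ≤ s)
    (h1 : r ≤ jb n) (h2 : jb n ≤ r + 1) (h1' : r ≤ jb n') (h2' : jb n' ≤ r + 1)
    (h3 : s ≤ jb (n + a)) (h4 : jb (n + a) ≤ s + 1)
    (h3' : s ≤ jb (n' + a)) (h4' : jb (n' + a) ≤ s + 1)
    (hq : 0 ≤ ((n 0 : ℝ) * a 1 - n 1 * a 0) * ((n' 0 : ℝ) * a 1 - n' 1 * a 0)) :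
    ((n 0 : ℝ) - n' 0) ^ 2 + ((n 1 : ℝ) - n' 1) ^ 2 ≤ 72 * (r * s / jb a) := by
  have hs0 : 0 ≤ s := by linarith
  have e1 := jb_sq n
  have e1' := jb_sq n'
  have e2 := jb_sq (n + a)
  have e2' := jb_sq (n' + a)
  have ea := jb_sq a
  have hA := one_le_jb a
  have hAle := jb_le_add n a
  simp only [Pi.add_apply, Int.cast_add] at e2 e2'
  have g1 : r ^ 2 ≤ jb n ^ 2 := by gcongr
  have g2 : jb n ^ 2 ≤ (r + 1) ^ 2 := by gcongr; exact (jb_pos n).le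
  have g1' : r ^ 2 ≤ jb n' ^ 2 := by gcongr
  have g2' : jb n' ^ 2 ≤ (r + 1) ^ 2 := by gcongr; exact (jb_pos n').le
  have g3 : s ^ 2 ≤ jb (n + a) ^ 2 := by gcongr
  have g4 : jb (n + a) ^ 2 ≤ (s + 1) ^ 2 := by gcongr; exact (jb_pos _).le
  have g3' : s ^ 2 ≤ jb (n' + a) ^ 2 := by gcongr
  have g4' : jb (n' + a) ^ 2 ≤ (s + 1) ^ 2 := by gcongr; exact (jb_pos _).le
  rw [e1] at g1 g2
  rw [e1'] at g1' g2'
  rw [e2] at g3 g4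
  rw [e2'] at g3' g4'
  rw [← mul_div_assoc, le_div_iff₀ (by linarith)]
  by_cases ha : a = 0
  · have : jb a = 1 := by simp [ha, jb]
    rw [this]
    have c1 : (r + 1) ^ 2 ≤ 4 * (r * s) := by nlinarith
    have c2 : 0 ≤ r * s := by positivity
    linarith [sq_nonneg ((n 0 : ℝ) + n' 0), sq_nonneg ((n 1 : ℝ) + n' 1)]
  have hint : (1 : ℤ) ≤ a 0 ^ 2 + a 1 ^ 2 := by
    by_contra! hlt
    apply ha
    have h0 : a 0 = 0 := by nlinarith [sq_nonneg (a 0), sq_nonneg (a 1)]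
    have h1 : a 1 = 0 := by nlinarith [sq_nonneg (a 0), sq_nonneg (a 1)]
    funext i
    fin_cases i <;> simp [h0, h1]
  have hone : (1 : ℝ) ≤ (a 0 : ℝ) ^ 2 + (a 1 : ℝ) ^ 2 := by exact_mod_cast hint
  exact sq_dist_mul_le _ _ _ _ _ _ _ r s hr hrs hA ea hone (by linarith) g1 g2 g1' g2' g3 g4
    g3' g4' hq

theorem card_le_card_filter_add {ι : Type*} (F : Finset ι) (p q : ι → Prop) [DecidablePred p]
    [DecidablePred q] (h : ∀ n ∈ F, p n ∨ q n) :
    (F.card : ℝ) ≤ ((F.filter p).card : ℝ) + ((F.filter q).card : ℝ) := by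
  classical
  have : F ⊆ F.filter p ∪ F.filter q := by
    intro n hn
    rcases h n hn with h | h <;> simp [hn, h]
  exact_mod_cast (Finset.card_le_card this).trans (Finset.card_union_le _ _)

theorem card_annulus_le (F : Finset (Fin 2 → ℤ)) (r D : ℝ) (hr : 1 ≤ r) (hD : 0 ≤ D)
    (h1 : ∀ n ∈ F, r ≤ jb n) (h2 : ∀ n ∈ F, jb n ≤ r + 1)
    (hd : ∀ n ∈ F, ∀ n' ∈ F, ((n 0 : ℝ) - n' 0) ^ 2 + ((n 1 : ℝ) - n' 1) ^ 2 ≤ D ^ 2) :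
    (F.card : ℝ) ≤ 16 * (D + 1) := by
  have g1 : ∀ n ∈ F, r ^ 2 ≤ 1 + (n 0 : ℝ) ^ 2 + (n 1 : ℝ) ^ 2 := by
    intro n hn
    rw [← jb_sq]
    exact pow_le_pow_left₀ (by linarith) (h1 n hn) 2
  have g2 : ∀ n ∈ F, 1 + (n 0 : ℝ) ^ 2 + (n 1 : ℝ) ^ 2 ≤ (r + 1) ^ 2 := by
    intro n hn
    rw [← jb_sq]
    exact pow_le_pow_left₀ (jb_pos n).le (h2 n hn) 2
  have d0 : ∀ n ∈ F, ∀ n' ∈ F, (n 0 : ℝ) - n' 0 ≤ D := fun n hn n' hn' =>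
    le_of_sq_le_sq (by nlinarith [hd n hn n' hn']) hD
  have d1 : ∀ n ∈ F, ∀ n' ∈ F, (n 1 : ℝ) - n' 1 ≤ D := fun n hn n' hn' =>
    le_of_sq_le_sq (by nlinarith [hd n hn n' hn']) hD
  have hext : ∀ n n' : Fin 2 → ℤ, n 0 = n' 0 → n 1 = n' 1 → n = n' := by
    intro n n' h0 h1
    funext i
    fin_cases i <;> assumption
  have hx : ∀ ε : ℤ, ε = 1 ∨ ε = -1 →
      ((F.filter (fun n => |n 1| ≤ ε * n 0)).card : ℝ) ≤ 4 * (D + 1) := by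
    intro ε hε
    have hε2 : (ε : ℝ) ^ 2 = 1 := by rcases hε with rfl | rfl <;> norm_num
    have hε0 : ε ≠ 0 := by rcases hε with rfl | rfl <;> norm_num
    refine card_sector_le _ (fun n => ε * n 0) (fun n => n 1) r D hr hD ?_ ?_ ?_ ?_ ?_
    · exact fun n _ n' _ h0 h1 => hext n n' (mul_left_cancel₀ hε0 h0) h1
    · intro n hn
      push_cast
      rw [mul_pow, hε2, one_mul]
      exact g1 n (Finset.mem_filter.mp hn).1
    · intro n hn
      push_cast
      rw [mul_pow, hε2, one_mul]
      exact g2 n (Finset.mem_filter.mp hn).1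
    · exact fun n hn => (Finset.mem_filter.mp hn).2
    · exact fun n hn n' hn' => d1 n (Finset.mem_filter.mp hn).1 n' (Finset.mem_filter.mp hn').1
  have hy : ∀ ε : ℤ, ε = 1 ∨ ε = -1 →
      ((F.filter (fun n => |n 0| ≤ ε * n 1)).card : ℝ) ≤ 4 * (D + 1) := by
    intro ε hε
    have hε2 : (ε : ℝ) ^ 2 = 1 := by rcases hε with rfl | rfl <;> norm_num
    have hε0 : ε ≠ 0 := by rcases hε with rfl | rfl <;> norm_num
    refine card_sector_le _ (fun n => ε * n 1) (fun n => n 0) r D hr hD ?_ ?_ ?_ ?_ ?_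
    · exact fun n _ n' _ h1 h0 => hext n n' h0 (mul_left_cancel₀ hε0 h1)
    · intro n hn
      push_cast
      rw [mul_pow, hε2, one_mul]
      linarith [g1 n (Finset.mem_filter.mp hn).1]
    · intro n hn
      push_cast
      rw [mul_pow, hε2, one_mul]
      linarith [g2 n (Finset.mem_filter.mp hn).1]
    · exact fun n hn => (Finset.mem_filter.mp hn).2
    · exact fun n hn n' hn' => d0 n (Finset.mem_filter.mp hn).1 n' (Finset.mem_filter.mp hn').1
  have s1 := card_le_card_filter_add F (fun n => |n 1| ≤ 1 * n 0 ∨ |n 1| ≤ -1 * n 0)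
    (fun n => |n 0| ≤ 1 * n 1 ∨ |n 0| ≤ -1 * n 1) (fun n _ => by grind)
  have s2 := card_le_card_filter_add (F.filter (fun n => |n 1| ≤ 1 * n 0 ∨ |n 1| ≤ -1 * n 0))
    (fun n => |n 1| ≤ 1 * n 0) (fun n => |n 1| ≤ -1 * n 0)
    (fun n hn => (Finset.mem_filter.mp hn).2)
  have s3 := card_le_card_filter_add (F.filter (fun n => |n 0| ≤ 1 * n 1 ∨ |n 0| ≤ -1 * n 1))
    (fun n => |n 0| ≤ 1 * n 1) (fun n => |n 0| ≤ -1 * n 1)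
    (fun n hn => (Finset.mem_filter.mp hn).2)
  have mono : ∀ (p q : (Fin 2 → ℤ) → Prop) [DecidablePred p] [DecidablePred q],
      (((F.filter p).filter q).card : ℝ) ≤ ((F.filter q).card : ℝ) := by
    intro p q _ _
    exact_mod_cast Finset.card_le_card (Finset.filter_subset_filter _ (Finset.filter_subset _ _))
  have := hx 1 (Or.inl rfl)
  have := hx (-1) (Or.inr rfl)
  have := hy 1 (Or.inl rfl)
  have := hy (-1) (Or.inr rfl)
  have := mono (fun n => |n 1| ≤ 1 * n 0 ∨ |n 1| ≤ -1 * n 0) (fun n => |n 1| ≤ 1 * n 0)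
  have := mono (fun n => |n 1| ≤ 1 * n 0 ∨ |n 1| ≤ -1 * n 0) (fun n => |n 1| ≤ -1 * n 0)
  have := mono (fun n => |n 0| ≤ 1 * n 1 ∨ |n 0| ≤ -1 * n 1) (fun n => |n 0| ≤ 1 * n 1)
  have := mono (fun n => |n 0| ≤ 1 * n 1 ∨ |n 0| ≤ -1 * n 1) (fun n => |n 0| ≤ -1 * n 1)
  linarith

theorem card_shells_le_of_le (F : Finset (Fin 2 → ℤ)) (a : Fin 2 → ℤ) (r s : ℝ) (hr : 1 ≤ r)
    (hrs : r ≤ s) (h1 : ∀ n ∈ F, r ≤ jb n) (h2 : ∀ n ∈ F, jb n ≤ r + 1)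
    (h3 : ∀ n ∈ F, s ≤ jb (n + a)) (h4 : ∀ n ∈ F, jb (n + a) ≤ s + 1) :
    (F.card : ℝ) ≤ 400 * √(r * s / jb a) := by
  rcases F.eq_empty_or_nonempty with rfl | ⟨n₀, hn₀⟩
  · simp
  have hA := jb_pos a
  have hs : 0 ≤ s := by linarith
  set t := r * s / jb a with ht
  have ht0 : 0 ≤ t := by positivity
  have ht4 : 1 / 4 ≤ t := by
    rw [ht, le_div_iff₀ hA]
    have := jb_le_add n₀ a
    have := h2 n₀ hn₀
    have := h4 n₀ hn₀
    nlinarith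
  have hone : 1 ≤ 2 * √t := by
    have : 1 / 2 ≤ √t := Real.le_sqrt_of_sq_le (by linarith)
    linarith
  have hsq : √t ^ 2 = t := Real.sq_sqrt ht0
  have half : ∀ G ⊆ F, (∀ n ∈ G, ∀ n' ∈ G,
      0 ≤ ((n 0 : ℝ) * a 1 - n 1 * a 0) * ((n' 0 : ℝ) * a 1 - n' 1 * a 0)) →
      (G.card : ℝ) ≤ 16 * (9 * √t + 1) := by
    intro G hG hq
    refine card_annulus_le G r _ hr (by positivity) (fun n hn => h1 n (hG hn))
      (fun n hn => h2 n (hG hn)) ?_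
    intro n hn n' hn'
    have := sq_dist_le_of_shells n n' a r s hr hrs (h1 n (hG hn)) (h2 n (hG hn)) (h1 n' (hG hn'))
      (h2 n' (hG hn')) (h3 n (hG hn)) (h4 n (hG hn)) (h3 n' (hG hn')) (h4 n' (hG hn'))
      (hq n hn n' hn')
    rw [mul_pow, hsq]
    linarith
  classical
  have hsplit := card_le_card_filter_add F (fun n => 0 ≤ (n 0 : ℝ) * a 1 - n 1 * a 0)
    (fun n => (n 0 : ℝ) * a 1 - n 1 * a 0 ≤ 0) (fun n _ => le_total _ _)
  have := half _ (Finset.filter_subset (fun n => 0 ≤ (n 0 : ℝ) * a 1 - n 1 * a 0) F)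
    (fun n hn n' hn' => mul_nonneg (Finset.mem_filter.mp hn).2 (Finset.mem_filter.mp hn').2)
  have := half _ (Finset.filter_subset (fun n => (n 0 : ℝ) * a 1 - n 1 * a 0 ≤ 0) F)
    (fun n hn n' hn' => mul_nonneg_of_nonpos_of_nonpos (Finset.mem_filter.mp hn).2
      (Finset.mem_filter.mp hn').2)
  linarith

/-- The number of lattice points in the intersection of two unit-thickness annuli. -/
theorem card_shells_le (F : Finset (Fin 2 → ℤ)) (a : Fin 2 → ℤ) (r s : ℝ) (hr : 1 ≤ r)
    (hs : 1 ≤ s) (h1 : ∀ n ∈ F, r ≤ jb n) (h2 : ∀ n ∈ F, jb n ≤ r + 1)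
    (h3 : ∀ n ∈ F, s ≤ jb (n + a)) (h4 : ∀ n ∈ F, jb (n + a) ≤ s + 1) :
    (F.card : ℝ) ≤ 400 * √(r * s / jb a) := by
  classical
  rcases le_total r s with h | h
  · exact card_shells_le_of_le F a r s hr h h1 h2 h3 h4
  · have := card_shells_le_of_le (F.image (fun n => n + a)) (-a) s r hs h
      (Finset.forall_mem_image.mpr h3) (Finset.forall_mem_image.mpr h4)
      (Finset.forall_mem_image.mpr (by simpa using h1))
      (Finset.forall_mem_image.mpr (by simpa using h2))
    rwa [jb_neg, Finset.card_image_of_injective _ (add_left_injective a), mul_comm s r] at this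

theorem sum_inv_sqrt_le (n : ℕ) : ∑ s ∈ Finset.Icc 1 n, (√(s : ℝ))⁻¹ ≤ 2 * √(n : ℝ) := by
  induction n with
  | zero => simp
  | succ n ih =>
    rw [Finset.sum_Icc_succ_top (by omega)]
    have hp : 0 < √((n + 1 : ℕ) : ℝ) := Real.sqrt_pos.mpr (by positivity)
    have h1 : √((n + 1 : ℕ) : ℝ) ^ 2 = n + 1 := by
      rw [Real.sq_sqrt (by positivity)]; push_cast; ring
    have h2 : √(n : ℝ) ^ 2 = n := Real.sq_sqrt (by positivity)
    have h3 : (√((n + 1 : ℕ) : ℝ))⁻¹ ≤ 2 * √((n + 1 : ℕ) : ℝ) - 2 * √(n : ℝ) := by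
      rw [inv_le_iff_one_le_mul₀ hp]
      nlinarith [sq_nonneg (√((n + 1 : ℕ) : ℝ) - √(n : ℝ))]
    linarith

theorem card_filter_fst_le (P : Finset (ℕ × ℕ)) (σ σ' μ : ℝ) (hσ : σ = -1 ∨ σ = 1)
    (hP : ∀ p ∈ P, |σ * p.2 + σ' * p.1 - μ| ≤ 3) (r : ℕ) :
    ((P.filter (fun p => p.1 = r)).card : ℝ) ≤ 7 := by
  have := card_le_of_sub_le (P.filter (fun p => p.1 = r)) (fun p => (p.2 : ℤ)) 6 (by norm_num)
    (by
      intro x hx y hy hxy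
      rw [Finset.mem_filter] at hx hy
      exact Prod.ext (hx.2.trans hy.2.symm) (by exact_mod_cast hxy))
    (by
      intro x hx y hy
      rw [Finset.mem_filter] at hx hy
      have h1 := abs_le.mp (hP x hx.1)
      have h2 := abs_le.mp (hP y hy.1)
      rw [hx.2] at h1
      rw [hy.2] at h2
      push_cast
      rcases hσ with rfl | rfl <;> linarith [h1.1, h1.2, h2.1, h2.2])
  linarith

theorem card_filter_snd_le (P : Finset (ℕ × ℕ)) (σ σ' μ : ℝ) (hσ' : σ' = -1 ∨ σ' = 1)
    (hP : ∀ p ∈ P, |σ * p.2 + σ' * p.1 - μ| ≤ 3) (s : ℕ) :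
    ((P.filter (fun p => p.2 = s)).card : ℝ) ≤ 7 := by
  have := card_le_of_sub_le (P.filter (fun p => p.2 = s)) (fun p => (p.1 : ℤ)) 6 (by norm_num)
    (by
      intro x hx y hy hxy
      rw [Finset.mem_filter] at hx hy
      exact Prod.ext (by exact_mod_cast hxy) (hx.2.trans hy.2.symm))
    (by
      intro x hx y hy
      rw [Finset.mem_filter] at hx hy
      have h1 := abs_le.mp (hP x hx.1)
      have h2 := abs_le.mp (hP y hy.1)
      rw [hx.2] at h1
      rw [hy.2] at h2
      push_cast
      rcases hσ' with rfl | rfl <;> linarith [h1.1, h1.2, h2.1, h2.2])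
  linarith

theorem card_pairs_le (P : Finset (ℕ × ℕ)) (σ σ' μ N : ℝ) (hN : 1 ≤ N) (hσ : σ = -1 ∨ σ = 1)
    (hP : ∀ p ∈ P, |σ * p.2 + σ' * p.1 - μ| ≤ 3)
    (hr : ∀ p ∈ P, 1 ≤ p.1 ∧ (p.1 : ℝ) ≤ 3 * N) : (P.card : ℝ) ≤ 21 * N := by
  have hmaps : ∀ p ∈ P, p.1 ∈ Finset.Icc 1 ⌊3 * N⌋₊ := fun p hp =>
    Finset.mem_Icc.mpr ⟨(hr p hp).1, Nat.le_floor (hr p hp).2⟩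
  have h : (P.card : ℝ) =
      ∑ r ∈ Finset.Icc 1 ⌊3 * N⌋₊, ((P.filter (fun p => p.1 = r)).card : ℝ) := by
    exact_mod_cast Finset.card_eq_sum_card_fiberwise hmaps
  rw [h]
  calc _ ≤ ∑ r ∈ Finset.Icc 1 ⌊3 * N⌋₊, (7 : ℝ) :=
        Finset.sum_le_sum fun r _ => card_filter_fst_le P σ σ' μ hσ hP r
    _ = ⌊3 * N⌋₊ * 7 := by simp
    _ ≤ 3 * N * 7 := by gcongr; exact Nat.floor_le (by linarith)
    _ = _ := by ring

theorem sum_pairs_inv_sqrt_le (P : Finset (ℕ × ℕ)) (σ σ' μ N : ℝ) (hN : 1 ≤ N)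
    (hσ : σ = -1 ∨ σ = 1) (hσ' : σ' = -1 ∨ σ' = 1)
    (hP : ∀ p ∈ P, |σ * p.2 + σ' * p.1 - μ| ≤ 3)
    (hr : ∀ p ∈ P, 1 ≤ p.1 ∧ (p.1 : ℝ) ≤ 3 * N) (hs : ∀ p ∈ P, 1 ≤ p.2) :
    ∑ p ∈ P, (√(p.2 : ℝ))⁻¹ ≤ 35 * √N := by
  have hNp : 0 < √N := Real.sqrt_pos.mpr (by linarith)
  rw [← Finset.sum_filter_add_sum_filter_not P (fun p => (p.2 : ℝ) ≤ N)]
  have hlow : ∑ p ∈ P.filter (fun p => (p.2 : ℝ) ≤ N), (√(p.2 : ℝ))⁻¹ ≤ 14 * √N := by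
    rw [← Finset.sum_fiberwise_of_maps_to (t := Finset.Icc 1 ⌊N⌋₊) (g := Prod.snd)
      (fun p hp => Finset.mem_Icc.mpr ⟨hs p (Finset.mem_filter.mp hp).1,
        Nat.le_floor (Finset.mem_filter.mp hp).2⟩)]
    calc _ ≤ ∑ s ∈ Finset.Icc 1 ⌊N⌋₊, 7 * (√(s : ℝ))⁻¹ := by
          refine Finset.sum_le_sum fun s _ => ?_
          rw [Finset.sum_congr rfl (g := fun _ => (√(s : ℝ))⁻¹)
            (fun p hp => by rw [(Finset.mem_filter.mp hp).2]), Finset.sum_const, nsmul_eq_mul]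
          gcongr
          exact card_filter_snd_le _ σ σ' μ hσ' (fun p hp => hP p (Finset.mem_filter.mp hp).1) s
      _ = 7 * ∑ s ∈ Finset.Icc 1 ⌊N⌋₊, (√(s : ℝ))⁻¹ := by rw [Finset.mul_sum]
      _ ≤ 7 * (2 * √(⌊N⌋₊ : ℝ)) := by gcongr; exact sum_inv_sqrt_le _
      _ ≤ 7 * (2 * √N) := by gcongr; exact Nat.floor_le (by linarith)
      _ = _ := by ring
  have hhigh : ∑ p ∈ P.filter (fun p => ¬ (p.2 : ℝ) ≤ N), (√(p.2 : ℝ))⁻¹ ≤ 21 * √N := by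
    calc _ ≤ ∑ p ∈ P.filter (fun p => ¬ (p.2 : ℝ) ≤ N), (√N)⁻¹ := by
          refine Finset.sum_le_sum fun p hp => ?_
          gcongr
          exact (not_le.mp (Finset.mem_filter.mp hp).2).le
      _ = ((P.filter (fun p => ¬ (p.2 : ℝ) ≤ N)).card : ℝ) * (√N)⁻¹ := by simp
      _ ≤ 21 * N * (√N)⁻¹ := by
          gcongr
          exact card_pairs_le _ σ σ' μ N hN hσ (fun p hp => hP p (Finset.mem_filter.mp hp).1)
            (fun p hp => hr p (Finset.mem_filter.mp hp).1)
      _ = 21 * √N := by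
          rw [mul_assoc, ← div_eq_mul_inv, Real.div_sqrt]
  linarith

theorem sum_inv_jb_add_le_of_pairs (T : Finset (Fin 2 → ℤ)) (a : Fin 2 → ℤ)
    (σ σ' μ N : ℝ) (hN : 1 ≤ N) (hσ : σ = -1 ∨ σ = 1) (hσ' : σ' = -1 ∨ σ' = 1)
    (hT : ∀ n ∈ T, jb n ≤ 3 * N)
    (hphase : ∀ n ∈ T, |σ * jb (n + a) + σ' * jb n - μ| ≤ 1) :
    ∃ P : Finset (ℕ × ℕ), (∀ p ∈ P, |σ * p.2 + σ' * p.1 - μ| ≤ 3) ∧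
      (∀ p ∈ P, 1 ≤ p.1 ∧ (p.1 : ℝ) ≤ 3 * N) ∧ (∀ p ∈ P, 1 ≤ p.2) ∧
      (∀ p ∈ P, jb a ≤ 3 * N + p.2 + 1) ∧
      ∑ n ∈ T, (jb (n + a))⁻¹ ≤ 400 * √(3 * N / jb a) * ∑ p ∈ P, (√(p.2 : ℝ))⁻¹ := by
  classical
  let g : (Fin 2 → ℤ) → ℕ × ℕ := fun n => (⌊jb n⌋₊, ⌊jb (n + a)⌋₊)
  have one_le : ∀ x : Fin 2 → ℤ, 1 ≤ ⌊jb x⌋₊ := fun x =>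
    Nat.le_floor (by simpa using one_le_jb x)
  have fle : ∀ x : Fin 2 → ℤ, (⌊jb x⌋₊ : ℝ) ≤ jb x := fun x => Nat.floor_le (jb_pos x).le
  have flt : ∀ x : Fin 2 → ℤ, jb x ≤ (⌊jb x⌋₊ : ℝ) + 1 := fun x => (Nat.lt_floor_add_one _).le
  refine ⟨T.image g, ?_, ?_, ?_, ?_, ?_⟩
  · rw [Finset.forall_mem_image]
    intro n hn
    have h := abs_le.mp (hphase n hn)
    have := fle n
    have := flt n
    have := fle (n + a)
    have := flt (n + a)
    simp only [g]
    rw [abs_le]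
    rcases hσ with rfl | rfl <;> rcases hσ' with rfl | rfl <;> constructor <;>
      linarith [h.1, h.2]
  · rw [Finset.forall_mem_image]
    exact fun n hn => ⟨one_le n, (fle n).trans (hT n hn)⟩
  · rw [Finset.forall_mem_image]
    exact fun n hn => one_le _
  · rw [Finset.forall_mem_image]
    intro n hn
    have := jb_le_add n a
    have := hT n hn
    have := flt (n + a)
    simp only [g]
    linarith
  · rw [← Finset.sum_fiberwise_of_maps_to (t := T.image g) (g := g)
      (fun n hn => Finset.mem_image_of_mem g hn), Finset.mul_sum]
    refine Finset.sum_le_sum ?_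
    rw [Finset.forall_mem_image]
    intro n₀ hn₀
    set r : ℝ := ((g n₀).1 : ℝ) with hr
    set s : ℝ := ((g n₀).2 : ℝ) with hs
    have hr1 : 1 ≤ r := Nat.one_le_cast.mpr (one_le n₀)
    have hs1 : 1 ≤ s := Nat.one_le_cast.mpr (one_le (n₀ + a))
    have hrN : r ≤ 3 * N := (fle n₀).trans (hT n₀ hn₀)
    have hfib : ∀ n ∈ T.filter (fun n => g n = g n₀), r = ⌊jb n⌋₊ ∧ s = ⌊jb (n + a)⌋₊ := by
      intro n hn
      have h := (Finset.mem_filter.mp hn).2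
      rw [hr, hs, ← h]
      exact ⟨rfl, rfl⟩
    have hcard := card_shells_le (T.filter (fun n => g n = g n₀)) a r s hr1 hs1
      (fun n hn => by rw [(hfib n hn).1]; exact fle n)
      (fun n hn => by rw [(hfib n hn).1]; exact flt n)
      (fun n hn => by rw [(hfib n hn).2]; exact fle _)
      (fun n hn => by rw [(hfib n hn).2]; exact flt _)
    have hA := jb_pos a
    have hsp : 0 < √s := Real.sqrt_pos.mpr (by linarith)
    calc _ ≤ ∑ n ∈ T.filter (fun n => g n = g n₀), s⁻¹ := by
          refine Finset.sum_le_sum fun n hn => ?_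
          gcongr
          rw [(hfib n hn).2]
          exact fle _
      _ = ((T.filter (fun n => g n = g n₀)).card : ℝ) * s⁻¹ := by simp
      _ ≤ 400 * √(3 * N * s / jb a) * s⁻¹ := by
          gcongr
          exact hcard.trans (by gcongr)
      _ = 400 * √(3 * N / jb a) * (√s)⁻¹ := by
          rw [mul_div_right_comm, Real.sqrt_mul (by positivity)]
          field_simp
          rw [Real.sq_sqrt (by linarith)]

theorem sum_inv_jb_add_le (T : Finset (Fin 2 → ℤ)) (a : Fin 2 → ℤ)
    (σ σ' μ N : ℝ) (hN : 1 ≤ N) (hσ : σ = -1 ∨ σ = 1) (hσ' : σ' = -1 ∨ σ' = 1)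
    (hT : ∀ n ∈ T, jb n ≤ 3 * N)
    (hphase : ∀ n ∈ T, |σ * jb (n + a) + σ' * jb n - μ| ≤ 1) :
    ∑ n ∈ T, (jb (n + a))⁻¹ ≤ 28000 * (N * (√(jb a))⁻¹) := by
  obtain ⟨P, hP, hr, hs, -, hle⟩ :=
    sum_inv_jb_add_le_of_pairs T a σ σ' μ N hN hσ hσ' hT hphase
  refine hle.trans ?_
  have hA := jb_pos a
  calc _ ≤ 400 * √(2 ^ 2 * N / jb a) * (35 * √N) := by
        gcongr
        · norm_num
        · exact sum_pairs_inv_sqrt_le P σ σ' μ N hN hσ hσ' hP hr hs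
    _ = 28000 * (√N * √N * (√(jb a))⁻¹) := by
        rw [Real.sqrt_div (by positivity), Real.sqrt_mul (by positivity),
          Real.sqrt_sq (by positivity)]
        ring
    _ = _ := by rw [Real.mul_self_sqrt (by linarith)]

theorem sum_inv_jb_add_le' (T : Finset (Fin 2 → ℤ)) (a : Fin 2 → ℤ)
    (σ σ' μ N : ℝ) (hN : 1 ≤ N) (hσ : σ = -1 ∨ σ = 1) (hσ' : σ' = -1 ∨ σ' = 1)
    (hT : ∀ n ∈ T, jb n ≤ 3 * N)
    (hphase : ∀ n ∈ T, |σ * jb (n + a) + σ' * jb n - μ| ≤ 1) :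
    ∑ n ∈ T, (jb (n + a))⁻¹ ≤ 84000 * (N * √N * (jb a)⁻¹) := by
  have hA := jb_pos a
  have hAp : 0 < √(jb a) := Real.sqrt_pos.mpr hA
  have hNp : 0 < √N := Real.sqrt_pos.mpr (by linarith)
  rcases le_total (jb a) (9 * N) with h | h
  · refine (sum_inv_jb_add_le T a σ σ' μ N hN hσ hσ' hT hphase).trans ?_
    have h1 : √(jb a) ≤ 3 * √N := by
      rw [Real.sqrt_le_left (by positivity), mul_pow, Real.sq_sqrt (by linarith)]
      linarith
    have h2 : (√(jb a))⁻¹ ≤ 3 * √N * (jb a)⁻¹ := by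
      rw [inv_le_iff_one_le_mul₀ hAp]
      have : √(jb a) * √(jb a) = jb a := Real.mul_self_sqrt hA.le
      calc 1 = √(jb a) * √(jb a) * (jb a)⁻¹ := by rw [this, mul_inv_cancel₀ hA.ne']
        _ ≤ (3 * √N) * √(jb a) * (jb a)⁻¹ := by gcongr
        _ = _ := by ring
    calc _ ≤ 28000 * (N * (3 * √N * (jb a)⁻¹)) := by gcongr
      _ = _ := by ring
  · obtain ⟨P, hP, hr, hs, ha, hle⟩ :=
      sum_inv_jb_add_le_of_pairs T a σ σ' μ N hN hσ hσ' hT hphase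
    refine hle.trans ?_
    have hsum : ∑ p ∈ P, (√(p.2 : ℝ))⁻¹ ≤ 21 * N * (2 * (√(jb a))⁻¹) := by
      calc _ ≤ ∑ p ∈ P, 2 * (√(jb a))⁻¹ := by
            refine Finset.sum_le_sum fun p hp => ?_
            have h1 : jb a ≤ 2 ^ 2 * (p.2 : ℝ) := by linarith [ha p hp]
            have h2 : √(jb a) ≤ 2 * √(p.2 : ℝ) := by
              calc _ ≤ √(2 ^ 2 * (p.2 : ℝ)) := by gcongr
                _ = _ := by rw [Real.sqrt_mul (by positivity), Real.sqrt_sq (by positivity)]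
            have h3 : 0 < √(p.2 : ℝ) := by linarith
            rw [← div_eq_mul_inv, inv_le_comm₀ h3 (by positivity), inv_div]
            linarith
        _ = (P.card : ℝ) * (2 * (√(jb a))⁻¹) := by simp
        _ ≤ _ := by
            gcongr
            exact card_pairs_le P σ σ' μ N hN hσ hP hr
    calc _ ≤ 400 * √(2 ^ 2 * N / jb a) * (21 * N * (2 * (√(jb a))⁻¹)) := by
          gcongr
          norm_num
      _ = 33600 * (N * √N * (√(jb a) * √(jb a))⁻¹) := by
          rw [Real.sqrt_div (by positivity), Real.sqrt_mul (by positivity),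
            Real.sqrt_sq (by positivity)]
          field_simp
          ring
      _ ≤ _ := by
          rw [Real.mul_self_sqrt hA.le]
          gcongr
          norm_num

theorem sum_range_rpow_neg_le (s : ℝ) (hs0 : 0 ≤ s) (hs1 : s < 1) (n : ℕ) :
    ∑ k ∈ Finset.range n, (1 + (k : ℝ)) ^ (-s) ≤ (n : ℝ) ^ (1 - s) / (1 - s) := by
  have hs : 0 < 1 - s := by linarith
  induction n with
  | zero => simp [Real.zero_rpow hs.ne']
  | succ n ih =>
    rw [Finset.sum_range_succ]
    have hp : (0 : ℝ) < n + 1 := by positivity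
    have hb : (1 + -1 / ((n : ℝ) + 1)) ^ (1 - s) ≤ 1 + (1 - s) * (-1 / ((n : ℝ) + 1)) :=
      rpow_one_add_le_one_add_mul_self
        (by rw [le_div_iff₀ hp]; linarith [(Nat.cast_nonneg n : (0 : ℝ) ≤ n)]) hs.le (by linarith)
    have hbase : 1 + -1 / ((n : ℝ) + 1) = n / (n + 1) := by field_simp; ring
    rw [hbase, Real.div_rpow (by positivity) hp.le, div_le_iff₀ (by positivity)] at hb
    have hsplit : ((n : ℝ) + 1) ^ (1 - s) = (n + 1) * ((n : ℝ) + 1) ^ (-s) := by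
      rw [sub_eq_add_neg, Real.rpow_add hp, Real.rpow_one]
    have hb' : (n : ℝ) ^ (1 - s) ≤
        ((n : ℝ) + 1) ^ (1 - s) - (1 - s) * ((n : ℝ) + 1) ^ (-s) := by
      refine hb.trans (le_of_eq ?_)
      rw [hsplit]
      field_simp
      ring
    have : (1 + (n : ℝ)) ^ (-s) ≤ (((n : ℝ) + 1) ^ (1 - s) - (n : ℝ) ^ (1 - s)) / (1 - s) := by
      rw [le_div_iff₀ hs, add_comm (1 : ℝ)]
      linarith
    push_cast
    rw [sub_div] at this
    linarith

theorem sum_Icc_rpow_neg_le (s : ℝ) (hs0 : 0 ≤ s) (hs1 : s < 1) (R : ℕ) :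
    ∑ x ∈ Finset.Icc (-(R : ℤ)) R, (1 + |(x : ℝ)|) ^ (-s) ≤
      2 / (1 - s) * ((R : ℝ) + 1) ^ (1 - s) := by
  rw [← Finset.sum_fiberwise_of_maps_to (t := Finset.range (R + 1)) (g := Int.natAbs)
    (fun x hx => by rw [Finset.mem_Icc] at hx; rw [Finset.mem_range]; omega)]
  calc _ ≤ ∑ k ∈ Finset.range (R + 1), 2 * (1 + (k : ℝ)) ^ (-s) := by
        refine Finset.sum_le_sum fun k _ => ?_
        rw [Finset.sum_congr rfl (g := fun _ => (1 + (k : ℝ)) ^ (-s)) (fun x hx => by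
          rw [← (Finset.mem_filter.mp hx).2, Nat.cast_natAbs, Int.cast_abs]),
          Finset.sum_const, nsmul_eq_mul]
        gcongr
        have : (Finset.Icc (-(R : ℤ)) R).filter (fun x => x.natAbs = k) ⊆
            {(k : ℤ), -(k : ℤ)} := by
          intro x hx
          have := (Finset.mem_filter.mp hx).2
          simp only [Finset.mem_insert, Finset.mem_singleton]
          omega
        exact_mod_cast (Finset.card_le_card this).trans Finset.card_le_two
    _ = 2 * ∑ k ∈ Finset.range (R + 1), (1 + (k : ℝ)) ^ (-s) := by rw [Finset.mul_sum]
    _ ≤ 2 * (((R + 1 : ℕ) : ℝ) ^ (1 - s) / (1 - s)) := by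
        gcongr
        exact sum_range_rpow_neg_le s hs0 hs1 _
    _ = _ := by push_cast; ring

theorem jb_rpow_neg_le (x : Fin 2 → ℤ) (s : ℝ) (hs0 : 0 ≤ s) (hs1 : s < 1) :
    jb x ^ (-(2 * s)) ≤ 2 * ((1 + |(x 0 : ℝ)|) ^ (-s) * (1 + |(x 1 : ℝ)|) ^ (-s)) := by
  have h1 := jb_sq x
  have hle : (1 + |(x 0 : ℝ)|) * (1 + |(x 1 : ℝ)|) ≤ 2 * jb x ^ 2 := by
    rw [h1, ← sq_abs (x 0 : ℝ), ← sq_abs (x 1 : ℝ)]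
    nlinarith [sq_nonneg (|(x 0 : ℝ)| - 1), sq_nonneg (|(x 1 : ℝ)| - 1),
      sq_nonneg (|(x 0 : ℝ)| - |(x 1 : ℝ)|), abs_nonneg (x 0 : ℝ), abs_nonneg (x 1 : ℝ)]
  have hj : jb x ^ (-(2 * s)) = 2 ^ s * (2 * jb x ^ 2) ^ (-s) := by
    rw [Real.mul_rpow (by norm_num) (by positivity), ← mul_assoc, ← Real.rpow_add (by norm_num),
      add_neg_cancel, Real.rpow_zero, one_mul, ← Real.rpow_natCast, ← Real.rpow_mul (jb_pos x).le]
    congr 1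
    push_cast
    ring
  rw [hj, ← Real.mul_rpow (by positivity) (by positivity)]
  refine mul_le_mul ?_ ?_ (by positivity) (by norm_num)
  · calc (2 : ℝ) ^ s ≤ 2 ^ (1 : ℝ) := Real.rpow_le_rpow_of_exponent_le (by norm_num) hs1.le
      _ = 2 := Real.rpow_one 2
  · exact Real.rpow_le_rpow_of_nonpos (by positivity) hle (by linarith)

theorem sum_jb_rpow_neg_le (U : Finset (Fin 2 → ℤ)) (s : ℝ) (hs0 : 0 ≤ s) (hs1 : s < 1) (R : ℕ)
    (hU : ∀ u ∈ U, ∀ i, |u i| ≤ R) :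
    ∑ u ∈ U, jb u ^ (-(2 * s)) ≤ 8 / (1 - s) ^ 2 * ((R : ℝ) + 1) ^ (2 - 2 * s) := by
  have hs : 0 < 1 - s := by linarith
  have hsub : U ⊆ Fintype.piFinset (fun _ : Fin 2 => Finset.Icc (-(R : ℤ)) R) := by
    intro u hu
    rw [Fintype.mem_piFinset]
    exact fun i => Finset.mem_Icc.mpr (abs_le.mp (hU u hu i))
  calc _ ≤ ∑ u ∈ Fintype.piFinset (fun _ : Fin 2 => Finset.Icc (-(R : ℤ)) R),
        2 * ∏ i, (1 + |(u i : ℝ)|) ^ (-s) := by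
        refine (Finset.sum_le_sum_of_subset_of_nonneg hsub
          (fun u _ _ => Real.rpow_nonneg (jb_pos u).le _)).trans (Finset.sum_le_sum fun u _ => ?_)
        rw [Fin.prod_univ_two]
        exact jb_rpow_neg_le u s hs0 hs1
    _ = 2 * (∑ x ∈ Finset.Icc (-(R : ℤ)) R, (1 + |(x : ℝ)|) ^ (-s)) ^ 2 := by
        rw [← Finset.mul_sum, ← Finset.prod_univ_sum
          (fun _ : Fin 2 => Finset.Icc (-(R : ℤ)) R) (fun _ x => (1 + |(x : ℝ)|) ^ (-s)),
          Fin.prod_univ_two, sq]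
    _ ≤ 2 * (2 / (1 - s) * ((R : ℝ) + 1) ^ (1 - s)) ^ 2 := by
        gcongr
        exact sum_Icc_rpow_neg_le s hs0 hs1 R
    _ = _ := by
        rw [mul_pow, ← Real.rpow_natCast (((R : ℝ) + 1) ^ (1 - s)), ← Real.rpow_mul (by positivity)]
        have : (1 - s) * ((2 : ℕ) : ℝ) = 2 - 2 * s := by push_cast; ring
        rw [this, div_pow]
        ring

theorem card_le_of_coord_le (T : Finset (Fin 2 → ℤ)) (N : ℝ) (hN : 1 ≤ N)
    (hT : ∀ n ∈ T, ∀ i, (|n i| : ℝ) ≤ 2 * N) : (T.card : ℝ) ≤ 25 * N ^ 2 := by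
  have hsub : T ⊆ Fintype.piFinset (fun _ : Fin 2 => Finset.Icc (-⌊2 * N⌋) ⌊2 * N⌋) := by
    intro n hn
    rw [Fintype.mem_piFinset]
    intro i
    rw [Finset.mem_Icc, ← abs_le]
    exact Int.le_floor.mpr (by push_cast; exact hT n hn i)
  have h := Finset.card_le_card hsub
  rw [Fintype.card_piFinset, Fin.prod_univ_two, Int.card_Icc] at h
  have hfl : (0 : ℤ) ≤ ⌊2 * N⌋ := Int.floor_nonneg.mpr (by linarith)
  have hc : (((⌊2 * N⌋ + 1 - -⌊2 * N⌋).toNat : ℕ) : ℝ) ≤ 5 * N := by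
    have h1 : (((⌊2 * N⌋ + 1 - -⌊2 * N⌋).toNat : ℕ) : ℤ) = 2 * ⌊2 * N⌋ + 1 := by omega
    have h2 : (((⌊2 * N⌋ + 1 - -⌊2 * N⌋).toNat : ℕ) : ℝ) = 2 * (⌊2 * N⌋ : ℝ) + 1 := by
      exact_mod_cast h1
    rw [h2]
    linarith [Int.floor_le (2 * N)]
  calc (T.card : ℝ) ≤ (((⌊2 * N⌋ + 1 - -⌊2 * N⌋).toNat : ℕ) : ℝ) *
        (((⌊2 * N⌋ + 1 - -⌊2 * N⌋).toNat : ℕ) : ℝ) := by exact_mod_cast h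
    _ ≤ (5 * N) * (5 * N) := by gcongr
    _ = _ := by ring

theorem sum_sum_jb_add_rpow_neg_le_of_le (T T' : Finset (Fin 2 → ℤ)) (L M s : ℝ) (hL : 1 ≤ L)
    (hLM : L ≤ M) (hs0 : 0 ≤ s) (hs1 : s < 1)
    (hT : ∀ n ∈ T, ∀ i, (|n i| : ℝ) ≤ 2 * L) (hT' : ∀ n ∈ T', ∀ i, (|n i| : ℝ) ≤ 2 * M) :
    ∑ n ∈ T, ∑ n' ∈ T', jb (n + n') ^ (-(2 * s)) ≤
      5000 / (1 - s) ^ 2 * (L ^ 2 * M ^ (2 - 2 * s)) := by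
  classical
  have hs : 0 < 1 - s := by linarith
  have inner : ∀ n ∈ T, ∑ n' ∈ T', jb (n + n') ^ (-(2 * s)) ≤
      8 / (1 - s) ^ 2 * (25 * M ^ (2 - 2 * s)) := by
    intro n hn
    rw [← Finset.sum_image (f := fun u => jb u ^ (-(2 * s))) (g := fun n' => n + n')
      (fun _ _ _ _ h => add_left_cancel h)]
    refine (sum_jb_rpow_neg_le _ s hs0 hs1 ⌊4 * M⌋₊ ?_).trans ?_
    · rw [Finset.forall_mem_image]
      intro n' hn' i
      have h1 := hT n hn i
      have h2 := hT' n' hn' i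
      have h3 : |n i + n' i| ≤ |n i| + |n' i| := abs_add_le _ _
      have h4 : (|n i| + |n' i|).toNat ≤ ⌊4 * M⌋₊ := by
        apply Nat.le_floor
        have : (((|n i| + |n' i|).toNat : ℕ) : ℤ) = |n i| + |n' i| :=
          Int.toNat_of_nonneg (by positivity)
        have h5 : (((|n i| + |n' i|).toNat : ℕ) : ℝ) = |(n i : ℝ)| + |(n' i : ℝ)| := by
          exact_mod_cast this
        rw [h5]
        linarith
      simp only [Pi.add_apply]
      omega
    · gcongr
      have hf : (⌊4 * M⌋₊ : ℝ) + 1 ≤ 5 * M := by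
        linarith [Nat.floor_le (by linarith : 0 ≤ 4 * M)]
      calc ((⌊4 * M⌋₊ : ℝ) + 1) ^ (2 - 2 * s) ≤ (5 * M) ^ (2 - 2 * s) :=
            Real.rpow_le_rpow (by positivity) hf (by linarith)
        _ = 5 ^ (2 - 2 * s) * M ^ (2 - 2 * s) := Real.mul_rpow (by norm_num) (by linarith)
        _ ≤ 25 * M ^ (2 - 2 * s) := by
          refine mul_le_mul_of_nonneg_right ?_ (Real.rpow_nonneg (by linarith) _)
          calc (5 : ℝ) ^ (2 - 2 * s) ≤ 5 ^ (2 : ℝ) :=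
                Real.rpow_le_rpow_of_exponent_le (by norm_num) (by linarith)
            _ = 25 := by norm_num
  have hM : 0 ≤ M := by linarith
  calc _ ≤ ∑ n ∈ T, 8 / (1 - s) ^ 2 * (25 * M ^ (2 - 2 * s)) := Finset.sum_le_sum inner
    _ = (T.card : ℝ) * (8 / (1 - s) ^ 2 * (25 * M ^ (2 - 2 * s))) := by simp
    _ ≤ (25 * L ^ 2) * (8 / (1 - s) ^ 2 * (25 * M ^ (2 - 2 * s))) := by
        gcongr
        exact card_le_of_coord_le T L hL hT
    _ = _ := by ring

theorem sum_sum_jb_add_rpow_neg_le (T T' : Finset (Fin 2 → ℤ)) (N N' s : ℝ) (hN : 1 ≤ N)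
    (hN' : 1 ≤ N') (hs0 : 0 ≤ s) (hs1 : s < 1)
    (hT : ∀ n ∈ T, ∀ i, (|n i| : ℝ) ≤ 2 * N) (hT' : ∀ n ∈ T', ∀ i, (|n i| : ℝ) ≤ 2 * N') :
    ∑ n ∈ T, ∑ n' ∈ T', jb (n + n') ^ (-(2 * s)) ≤
      5000 / (1 - s) ^ 2 * (min N N' ^ 2 * max N N' ^ (2 - 2 * s)) := by
  rcases le_total N N' with h | h
  · rw [min_eq_left h, max_eq_right h]
    exact sum_sum_jb_add_rpow_neg_le_of_le T T' N N' s hN h hs0 hs1 hT hT'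
  · rw [min_eq_right h, max_eq_left h, Finset.sum_comm]
    refine (Finset.sum_congr rfl fun n' _ => Finset.sum_congr rfl fun n _ => ?_).trans_le
      (sum_sum_jb_add_rpow_neg_le_of_le T' T N' N s hN' h hs0 hs1 hT' hT)
    rw [add_comm]

theorem sum_inv_jb_add_le_rpow_half (T : Finset (Fin 2 → ℤ)) (a : Fin 2 → ℤ)
    (σ σ' μ N : ℝ) (hN : 1 ≤ N) (hσ : σ = -1 ∨ σ = 1) (hσ' : σ' = -1 ∨ σ' = 1)
    (hT : ∀ n ∈ T, jb n ≤ 3 * N)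
    (hphase : ∀ n ∈ T, |σ * jb (n + a) + σ' * jb n - μ| ≤ 1) :
    ∑ n ∈ T, (jb (n + a))⁻¹ ≤ 84000 * (N ^ (1 : ℝ) * jb a ^ (-(1 / 2) : ℝ)) := by
  have hA := jb_pos a
  refine (sum_inv_jb_add_le T a σ σ' μ N hN hσ hσ' hT hphase).trans ?_
  rw [Real.rpow_one, Real.rpow_neg hA.le, ← Real.sqrt_eq_rpow]
  gcongr
  norm_num

theorem sum_inv_jb_add_le_rpow_three_quarters (T : Finset (Fin 2 → ℤ)) (a : Fin 2 → ℤ)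
    (σ σ' μ N : ℝ) (hN : 1 ≤ N) (hσ : σ = -1 ∨ σ = 1) (hσ' : σ' = -1 ∨ σ' = 1)
    (hT : ∀ n ∈ T, jb n ≤ 3 * N)
    (hphase : ∀ n ∈ T, |σ * jb (n + a) + σ' * jb n - μ| ≤ 1) :
    ∑ n ∈ T, (jb (n + a))⁻¹ ≤ 84000 * (N ^ (5 / 4 : ℝ) * jb a ^ (-(3 / 4) : ℝ)) := by
  have hA := jb_pos a
  have hN0 : 0 < N := by linarith
  have b1 := sum_inv_jb_add_le_rpow_half T a σ σ' μ N hN hσ hσ' hT hphase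
  have b2 := sum_inv_jb_add_le' T a σ σ' μ N hN hσ hσ' hT hphase
  have h0 : 0 ≤ ∑ n ∈ T, (jb (n + a))⁻¹ := Finset.sum_nonneg fun n _ => (inv_pos.mpr (jb_pos _)).le
  apply le_of_sq_le_sq _ (by positivity)
  rw [sq]
  refine (mul_le_mul b1 b2 h0 (by positivity)).trans (le_of_eq ?_)
  have e1 : (N ^ (5 / 4 : ℝ)) ^ 2 = N ^ (1 : ℝ) * (N * √N) := by
    rw [Real.sqrt_eq_rpow, Real.rpow_one, ← Real.rpow_natCast, ← Real.rpow_mul hN0.le]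
    nth_rewrite 2 [← Real.rpow_one N]
    nth_rewrite 3 [← Real.rpow_one N]
    rw [← Real.rpow_add hN0, ← Real.rpow_add hN0]
    norm_num
  have e2 : (jb a ^ (-(3 / 4) : ℝ)) ^ 2 = jb a ^ (-(1 / 2) : ℝ) * (jb a)⁻¹ := by
    rw [← Real.rpow_neg_one, ← Real.rpow_natCast, ← Real.rpow_mul hA.le, ← Real.rpow_add hA]
    norm_num
  rw [mul_pow, mul_pow, e1, e2]
  ring

theorem dyadic_product_le (N m M β t : ℝ) (hm : 1 ≤ m) (hmM : m ≤ M)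
    (hN : 1 ≤ N) (hβ2 : β ≤ 5 / 4)
    (h : (M ≤ N ∧ t = 0 ∧ 7 / 6 < β) ∨ (N ≤ M ∧ t = 1 / 4)) :
    (N ^ (-β) * (m ^ (-β) * M ^ (-β))) * (N ^ (1 + t) * (m ^ 2 * M ^ (1 / 2 - t))) ≤
      max N M ^ (7 / 2 - 3 * β) := by
  have hN0 : 0 < N := by linarith
  have hm0 : 0 < m := by linarith
  have hM0 : 0 < M := by linarith
  have hM1 : 1 ≤ M := by linarith
  have e : (N ^ (-β) * (m ^ (-β) * M ^ (-β))) * (N ^ (1 + t) * (m ^ 2 * M ^ (1 / 2 - t))) =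
      N ^ (1 + t - β) * (m ^ (2 - β) * M ^ (1 / 2 - t - β)) := by
    rw [show 1 + t - β = -β + (1 + t) by ring, show 2 - β = -β + 2 by ring,
      show 1 / 2 - t - β = -β + (1 / 2 - t) by ring, Real.rpow_add hN0 (-β) (1 + t),
      Real.rpow_add hm0, Real.rpow_add hM0, Real.rpow_two]
    ring
  rw [e]
  have e2 : N ^ (1 + t - β) * (m ^ (2 - β) * M ^ (1 / 2 - t - β)) ≤
      N ^ (1 + t - β) * M ^ (5 / 2 - t - 2 * β) := by
    rw [show 5 / 2 - t - 2 * β = (2 - β) + (1 / 2 - t - β) by ring, Real.rpow_add hM0]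
    gcongr
    linarith
  refine e2.trans ?_
  rcases h with ⟨h, rfl, -⟩ | ⟨h, rfl⟩
  · rw [max_eq_left h, show 7 / 2 - 3 * β = (1 + 0 - β) + (5 / 2 - 0 - 2 * β) by ring,
      Real.rpow_add hN0]
    gcongr
    linarith
  · rw [max_eq_right h, show 7 / 2 - 3 * β = (1 + 1 / 4 - β) + (5 / 2 - 1 / 4 - 2 * β) by ring,
      Real.rpow_add hM0]
    gcongr
    linarith

theorem jb_rpow_le (x : Fin 2 → ℤ) (e β N : ℝ) (he : e ≤ -β) (hβ0 : 0 ≤ β) (hβ2 : β ≤ 2)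
    (hN : 0 < N) (hx : N / 2 ≤ jb x) : jb x ^ e ≤ 4 * N ^ (-β) := by
  calc jb x ^ e ≤ jb x ^ (-β) := Real.rpow_le_rpow_of_exponent_le (one_le_jb x) he
    _ ≤ (N / 2) ^ (-β) := Real.rpow_le_rpow_of_nonpos (by positivity) hx (by linarith)
    _ = 2 ^ β * N ^ (-β) := by
        rw [Real.div_rpow hN.le (by norm_num), Real.rpow_neg (by norm_num : (0 : ℝ) ≤ 2),
          div_inv_eq_mul, mul_comm]
    _ ≤ 4 * N ^ (-β) := by
        refine mul_le_mul_of_nonneg_right ?_ (Real.rpow_nonneg hN.le _)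
        calc (2 : ℝ) ^ β ≤ 2 ^ (2 : ℝ) := Real.rpow_le_rpow_of_exponent_le (by norm_num) hβ2
          _ = 4 := by norm_num

theorem sum_le_of_inner_sum_le (T T' : Finset (Fin 2 → ℤ)) (S : (Fin 2 → ℤ) → (Fin 2 → ℤ) → ℝ)
    (N L K β t : ℝ) (hN : 1 ≤ N) (hL : 1 ≤ L) (hK : 1 ≤ K) (hβ2 : β ≤ 5 / 4)
    (ht : (max L K ≤ N ∧ t = 0 ∧ 7 / 6 < β) ∨ (N ≤ max L K ∧ t = 1 / 4))
    (hT : ∀ n ∈ T, ∀ i, (|n i| : ℝ) ≤ 2 * L) (hT' : ∀ n ∈ T', ∀ i, (|n i| : ℝ) ≤ 2 * K)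
    (hS : ∀ n ∈ T, ∀ n' ∈ T', S n n' ≤ 84000 * (N ^ (1 + t) * jb (n + n') ^ (-(1 / 2 + t)))) :
    ∑ n ∈ T, ∑ n' ∈ T', (jb (n + n'))⁻¹ * (64 * (N ^ (-β) * (L ^ (-β) * K ^ (-β)))) * S n n' ≤
      10 ^ 13 * max N (max L K) ^ (7 / 2 - 3 * β) := by
  have hN0 : 0 < N := by linarith
  have hL0 : 0 < L := by linarith
  have hK0 : 0 < K := by linarith
  have ht01 : 0 ≤ t ∧ t ≤ 1 / 4 := by
    rcases ht with ⟨-, rfl, -⟩ | ⟨-, rfl⟩ <;> norm_num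
  set s := 3 / 4 + t / 2 with hs
  set W := N ^ (-β) * (L ^ (-β) * K ^ (-β)) with hW
  have hW0 : 0 ≤ W := by positivity
  have hLK : L ^ (-β) * K ^ (-β) = min L K ^ (-β) * max L K ^ (-β) := by
    rw [← Real.mul_rpow hL0.le hK0.le, ← Real.mul_rpow (by positivity) (by positivity),
      min_mul_max]
  have hdy := dyadic_product_le N (min L K) (max L K) β t (le_min hL hK)
    (min_le_max) hN hβ2 ht
  rw [← hLK, ← hW] at hdy
  have hcs : 5000 / (1 - s) ^ 2 ≤ 320000 := by
    rw [div_le_iff₀ (by rw [hs]; apply pow_pos; linarith [ht01.2])]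
    nlinarith [ht01.2]
  calc _ ≤ ∑ n ∈ T, ∑ n' ∈ T', (64 * 84000 * (W * N ^ (1 + t))) * jb (n + n') ^ (-(2 * s)) := by
        refine Finset.sum_le_sum fun n hn => Finset.sum_le_sum fun n' hn' => ?_
        have hA := jb_pos (n + n')
        have e : jb (n + n') ^ (-(2 * s)) = (jb (n + n'))⁻¹ * jb (n + n') ^ (-(1 / 2 + t)) := by
          rw [← Real.rpow_neg_one, ← Real.rpow_add hA, hs]
          congr 1
          ring
        rw [e]
        calc _ ≤ (jb (n + n'))⁻¹ * (64 * W) *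
              (84000 * (N ^ (1 + t) * jb (n + n') ^ (-(1 / 2 + t)))) := by
              gcongr
              exact hS n hn n' hn'
          _ = _ := by ring
    _ = (64 * 84000 * (W * N ^ (1 + t))) * ∑ n ∈ T, ∑ n' ∈ T', jb (n + n') ^ (-(2 * s)) := by
        simp_rw [Finset.mul_sum]
    _ ≤ (64 * 84000 * (W * N ^ (1 + t))) *
        (320000 * (min L K ^ 2 * max L K ^ (2 - 2 * s))) := by
        gcongr
        refine (sum_sum_jb_add_rpow_neg_le T T' L K s hL hK (by linarith [ht01.1])
          (by linarith [ht01.2]) hT hT').trans ?_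
        gcongr
    _ = 1720320000000 * (W * (N ^ (1 + t) * (min L K ^ 2 * max L K ^ (1 / 2 - t)))) := by
        rw [show 2 - 2 * s = 1 / 2 - t by rw [hs]; ring]
        ring
    _ ≤ 1720320000000 * max N (max L K) ^ (7 / 2 - 3 * β) := by gcongr
    _ ≤ _ := by gcongr; norm_num

theorem coord_le_of_ann {N : ℝ} {x : Fin 2 → ℤ} (h : ann N x) (i : Fin 2) :
    (|x i| : ℝ) ≤ 2 * N := by
  refine le_trans ?_ h.2
  rw [znorm]
  apply Real.abs_le_sqrt
  fin_cases i <;> simp <;> positivity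

theorem half_le_jb_of_ann {N : ℝ} {x : Fin 2 → ℤ} (h : ann N x) : N / 2 ≤ jb x :=
  h.1.trans (Real.sqrt_le_sqrt (by linarith))

theorem jb_le_of_ann {N : ℝ} (hN : 1 ≤ N) {x : Fin 2 → ℤ} (h : ann N x) : jb x ≤ 3 * N := by
  have h1 : znorm x ^ 2 = (x 0 : ℝ) ^ 2 + (x 1 : ℝ) ^ 2 := Real.sq_sqrt (by positivity)
  have h2 : znorm x ^ 2 ≤ (2 * N) ^ 2 := pow_le_pow_left₀ (Real.sqrt_nonneg _) h.2 2
  apply le_of_sq_le_sq _ (by positivity)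
  rw [jb_sq]
  nlinarith

theorem finite_setOf_ann (N : ℝ) : {x : Fin 2 → ℤ | ann N x}.Finite := by
  refine (Fintype.piFinset (fun _ : Fin 2 => Finset.Icc (-⌊2 * N⌋) ⌊2 * N⌋)).finite_toSet.subset ?_
  intro x hx
  rw [Finset.mem_coe, Fintype.mem_piFinset]
  intro i
  rw [Finset.mem_Icc, ← abs_le]
  exact Int.le_floor.mpr (by push_cast; exact coord_le_of_ann hx i)

/-- A sum over triples, organised with the first entry innermost. -/
theorem tsum_triple_eq (T₀ T₁ T₂ : Finset (Fin 2 → ℤ)) (f : (Fin 3 → Fin 2 → ℤ) → ℝ)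
    (hf : ∀ v, f v ≠ 0 → v 0 ∈ T₀ ∧ v 1 ∈ T₁ ∧ v 2 ∈ T₂) :
    ∑' v, f v = ∑ y ∈ T₁, ∑ z ∈ T₂, ∑ x ∈ T₀, f ![x, y, z] := by
  classical
  let g : (Fin 2 → ℤ) × (Fin 2 → ℤ) × (Fin 2 → ℤ) → Fin 3 → Fin 2 → ℤ :=
    fun p => ![p.2.2, p.1, p.2.1]
  have hg : Function.Injective g := by
    intro p q h
    exact Prod.ext (congrFun h 1) (Prod.ext (congrFun h 2) (congrFun h 0))
  rw [tsum_eq_sum (s := (T₁ ×ˢ T₂ ×ˢ T₀).image g), Finset.sum_image hg.injOn,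
    Finset.sum_product]
  · exact Finset.sum_congr rfl fun y _ => Finset.sum_product _ _ _
  · intro v hv
    by_contra hne
    obtain ⟨h0, h1, h2⟩ := hf v hne
    refine hv (Finset.mem_image.mpr ⟨(v 1, v 2, v 0), by simp [h0, h1, h2], ?_⟩)
    funext i
    fin_cases i <;> rfl

/-- special cubic sum estimate for the quintic term: for `1/4 ≤ α < 5/12`
there exist `ε > 0` and `C > 0` depending only on `α` such that for all signs, dyadic
`N₂, N₃, N₄` and every `m ∈ ℤ`,
`∑_{n₂,n₃,n₄} ⟨n₂+n₃+n₄⟩⁻¹ ⟨n₃+n₄⟩⁻¹ ∏_j 1_{|n_j|∼N_j} ⟨n_j⟩^{−2+2α} 1_{|ψ−m|≤1}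
  ≤ C max(N₂,N₃,N₄)^{−2ε}`. -/
theorem special_cubic_sum_estimate (α : ℝ) (hα0 : 1 / 4 ≤ α) (hα1 : α < 5 / 12) :
    ∃ ε C : ℝ, 0 < ε ∧ 0 < C ∧
      ∀ (σ σ₂ σ₃ σ₄ : ℝ), (σ = -1 ∨ σ = 1) → (σ₂ = -1 ∨ σ₂ = 1) →
        (σ₃ = -1 ∨ σ₃ = 1) → (σ₄ = -1 ∨ σ₄ = 1) →
        ∀ (k₂ k₃ k₄ : ℕ) (m : ℤ),
          (∑' v : Fin 3 → Fin 2 → ℤ,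
            Set.indicator
              {v : Fin 3 → Fin 2 → ℤ |
                ann ((2:ℝ)^k₂) (v 0) ∧ ann ((2:ℝ)^k₃) (v 1) ∧ ann ((2:ℝ)^k₄) (v 2) ∧
                |phase σ σ₂ σ₃ σ₄ (v 0) (v 1) (v 2) - (m : ℝ)| ≤ 1}
              (fun v => (jb (v 0 + v 1 + v 2))⁻¹ * (jb (v 1 + v 2))⁻¹ *
                (jb (v 0) ^ (-2 + 2 * α) * jb (v 1) ^ (-2 + 2 * α) *
                  jb (v 2) ^ (-2 + 2 * α))) v) ≤
            C * (max ((2:ℝ)^k₂) (max ((2:ℝ)^k₃) ((2:ℝ)^k₄))) ^ (-2 * ε) := by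
  set β := min (2 - 2 * α) (5 / 4) with hβ
  have hβ1 : 7 / 6 < β := lt_min (by linarith) (by norm_num)
  have hβ2 : β ≤ 5 / 4 := min_le_right _ _
  have hβα : -2 + 2 * α ≤ -β := by linarith [min_le_left (2 - 2 * α) (5 / 4)]
  refine ⟨(3 * β - 7 / 2) / 2, 10 ^ 13, by linarith, by norm_num, ?_⟩
  intro σ σ₂ σ₃ σ₄ hσ hσ₂ _ _ k₂ k₃ k₄ m
  have hpow : ∀ k : ℕ, (1 : ℝ) ≤ 2 ^ k := fun k => one_le_pow₀ (by norm_num)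
  have hN := hpow k₂
  have hL := hpow k₃
  have hK := hpow k₄
  generalize (2 : ℝ) ^ k₂ = N at *
  generalize (2 : ℝ) ^ k₃ = L at *
  generalize (2 : ℝ) ^ k₄ = K at *
  have hmem : ∀ (M : ℝ) (x : Fin 2 → ℤ), x ∈ (finite_setOf_ann M).toFinset ↔ ann M x :=
    fun M x => Set.Finite.mem_toFinset _
  rw [show -2 * ((3 * β - 7 / 2) / 2) = 7 / 2 - 3 * β by ring,
    tsum_triple_eq (finite_setOf_ann N).toFinset (finite_setOf_ann L).toFinset
      (finite_setOf_ann K).toFinset _ (by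
        intro v hv
        have h := Set.mem_of_indicator_ne_zero hv
        simp only [hmem]
        exact ⟨h.1, h.2.1, h.2.2.1⟩)]
  classical
  let G : (Fin 2 → ℤ) → (Fin 2 → ℤ) → Finset (Fin 2 → ℤ) := fun y z =>
    (finite_setOf_ann N).toFinset.filter (fun x =>
      |σ * jb (x + (y + z)) + σ₂ * jb x - (m - σ₃ * jb y - σ₄ * jb z)| ≤ 1)
  let S : (Fin 2 → ℤ) → (Fin 2 → ℤ) → ℝ := fun y z => ∑ x ∈ G y z, (jb (x + (y + z)))⁻¹
  have hG1 : ∀ y z, ∀ x ∈ G y z, jb x ≤ 3 * N := fun y z x hx =>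
    jb_le_of_ann hN ((hmem N x).mp (Finset.mem_filter.mp hx).1)
  have hG2 : ∀ y z, ∀ x ∈ G y z,
      |σ * jb (x + (y + z)) + σ₂ * jb x - (m - σ₃ * jb y - σ₄ * jb z)| ≤ 1 :=
    fun y z x hx => (Finset.mem_filter.mp hx).2
  have hcoord : ∀ M : ℝ, ∀ n ∈ (finite_setOf_ann M).toFinset, ∀ i, (|n i| : ℝ) ≤ 2 * M :=
    fun M n hn i => coord_le_of_ann ((hmem M n).mp hn) i
  calc _ ≤ ∑ y ∈ (finite_setOf_ann L).toFinset, ∑ z ∈ (finite_setOf_ann K).toFinset,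
        (jb (y + z))⁻¹ * (64 * (N ^ (-β) * (L ^ (-β) * K ^ (-β)))) * S y z := by
        refine Finset.sum_le_sum fun y hy => Finset.sum_le_sum fun z hz => ?_
        rw [hmem] at hy hz
        simp only [S, G]
        rw [Finset.mul_sum, Finset.sum_filter]
        refine Finset.sum_le_sum fun x hx => ?_
        rw [hmem] at hx
        have hphase : phase σ σ₂ σ₃ σ₄ x y z - m =
            σ * jb (x + (y + z)) + σ₂ * jb x - (m - σ₃ * jb y - σ₄ * jb z) := by
          rw [phase, add_assoc x y z]
          ring
        rw [Set.indicator_apply]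
        simp only [Set.mem_ofPred_eq, Matrix.cons_val_zero, Matrix.cons_val_one, Matrix.cons_val,
          hx, hy, hz, true_and, hphase]
        split_ifs
        · have h1 := jb_rpow_le x _ β N hβα (by linarith) (by linarith) (by linarith)
            (half_le_jb_of_ann hx)
          have h2 := jb_rpow_le y _ β L hβα (by linarith) (by linarith) (by linarith)
            (half_le_jb_of_ann hy)
          have h3 := jb_rpow_le z _ β K hβα (by linarith) (by linarith) (by linarith)
            (half_le_jb_of_ann hz)
          have p1 := jb_pos x
          have p2 := jb_pos y
          have p3 := jb_pos z
          have p4 := jb_pos (y + z)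
          have p5 := jb_pos (x + (y + z))
          rw [add_assoc x y z]
          calc _ ≤ (jb (x + (y + z)))⁻¹ * (jb (y + z))⁻¹ *
                ((4 * N ^ (-β)) * (4 * L ^ (-β)) * (4 * K ^ (-β))) := by gcongr
            _ = _ := by ring
        · exact le_rfl
    _ ≤ _ := by
        rcases le_total (max L K) N with h | h
        · refine sum_le_of_inner_sum_le _ _ S N L K β 0 hN hL hK hβ2 (Or.inl ⟨h, rfl, hβ1⟩)
            (hcoord L) (hcoord K) fun y _ z _ => ?_
          simp only [add_zero]
          exact sum_inv_jb_add_le_rpow_half (G y z) (y + z) σ σ₂ _ N hN hσ hσ₂ (hG1 y z) (hG2 y z)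
        · refine sum_le_of_inner_sum_le _ _ S N L K β (1 / 4) hN hL hK hβ2 (Or.inr ⟨h, rfl⟩)
            (hcoord L) (hcoord K) fun y _ z _ => ?_
          have := sum_inv_jb_add_le_rpow_three_quarters (G y z) (y + z) σ σ₂ _ N hN hσ hσ₂
            (hG1 y z) (hG2 y z)
          norm_num at this ⊢
          exact this
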